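/- arXiv:1809.05695 — 4 statements merged into one kernel-verified Lean document; each statement's English description precedes it below -/
import Mathlib

section
/- Let N ≥ 2 be an integer, let 0 < γ ≤ π/2 and let μ > N be a real number. Let g : [0,γ] → ℝ be continuous on [0,γ], twice continuously differentiable on (0,γ], positive on (0,γ], satisfy the equation -g''(θ) - (N-1) cot(θ) g'(θ) + (N-1) g(θ)/sin²(θ) = μ g(θ) for all θ ∈ (0,γ), satisfy g(0) = 0 and g'(γ) = 0, and satisfy the asymptotic expansions g(θ) = θ - a θ³ + o(θ³) and g'(θ) = 1 - 3 a θ² + o(θ²) as θ → 0⁺, where a = (μ - (2/3)(N-1))/(2N+4). Define G : (0, π/2] → ℝ by G(θ) = g(θ) for θ ≤ γ and G(θ) = g(γ) for θ > γ. Then the function θ ↦ G(θ)/sin(θ) is strictly decreasing on (0, π/2]. -/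
open Real Set Filter Asymptotics Topology

/-- If `f θ = 1 - 3 a θ² + o(θ²)` as `θ → 0⁺`, then `f` tends to `1` at `0⁺`. -/
lemma tendsto_one_of_isLittleO_sq {f : ℝ → ℝ} {a : ℝ}
    (h : (fun θ => f θ - (1 - 3 * a * θ ^ 2)) =o[𝓝[>] 0] fun θ => θ ^ 2) :
    Tendsto f (𝓝[>] 0) (𝓝 1) := by
  have hsq : Tendsto (fun θ : ℝ => θ ^ 2) (𝓝[>] 0) (𝓝 0) := by
    have : Continuous fun θ : ℝ => θ ^ 2 := by fun_prop
    simpa using (this.tendsto 0).mono_left nhdsWithin_le_nhds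
  have hpoly : Tendsto (fun θ : ℝ => 1 - 3 * a * θ ^ 2) (𝓝[>] 0) (𝓝 1) := by
    simpa using (hsq.const_mul (3 * a)).const_sub 1
  simpa using (h.trans_tendsto hsq).add hpoly

/-- The weighted Wronskian of `g` and `sin`, where `sin` solves the same equation with
eigenvalue `N = k + 2`, is negative on `(0, γ]`. -/
lemma wronskian_sin_neg {k : ℕ} {γ μ : ℝ} (hγ : γ ≤ π / 2) (hμ : (k : ℝ) + 2 < μ)
    {g g' g'' : ℝ → ℝ} (hgc : ContinuousOn g (Icc 0 γ))
    (hg' : ∀ θ ∈ Ioo 0 γ, HasDerivAt g (g' θ) θ)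
    (hg'' : ∀ θ ∈ Ioo 0 γ, HasDerivAt g' (g'' θ) θ)
    (hg'c : ContinuousOn g' (Ioc 0 γ))
    (hgpos : ∀ θ ∈ Ioc 0 γ, 0 < g θ)
    (hode : ∀ θ ∈ Ioo 0 γ,
      -g'' θ - ((k : ℝ) + 1) * (cos θ / sin θ) * g' θ
        + ((k : ℝ) + 1) * g θ / sin θ ^ 2 = μ * g θ)
    (hlim : Tendsto g' (𝓝[>] 0) (𝓝 1)) :
    ∀ θ ∈ Ioc 0 γ, g' θ * sin θ - g θ * cos θ < 0 := by
  intro θ hθ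
  have hsin : ∀ x ∈ Ioc 0 γ, 0 < sin x := fun x hx =>
    sin_pos_of_pos_of_lt_pi hx.1 (by linarith [hx.2, pi_pos])
  have hcont : ContinuousOn
      (fun x => sin x ^ (k + 1) * (g' x * sin x - g x * cos x)) (Icc 0 γ) := by
    have hγ0 : 0 ≤ γ := hθ.1.le.trans hθ.2
    have hg's : ContinuousOn (fun x => g' x * sin x) (Icc 0 γ) := by
      intro x hx
      rcases hx.1.eq_or_lt with rfl | hx0
      · rw [← Ioc_insert_left hγ0, continuousWithinAt_insert_self]
        have h1 : Tendsto sin (𝓝[>] 0) (𝓝 (sin 0)) :=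
          (continuous_sin.tendsto 0).mono_left nhdsWithin_le_nhds
        have h2 := (hlim.mul h1).mono_left
          (nhdsWithin_mono 0 (t := Ioi 0) (s := Ioc 0 γ) Ioc_subset_Ioi_self)
        simpa [ContinuousWithinAt] using h2
      · have h := (hg'c x ⟨hx0, hx.2⟩).mul continuous_sin.continuousWithinAt
        refine h.mono_of_mem_nhdsWithin ?_
        filter_upwards [self_mem_nhdsWithin, mem_nhdsWithin_of_mem_nhds (Ioi_mem_nhds hx0)]
          with y hy hy0 using ⟨hy0, hy.2⟩
    exact (continuous_sin.pow _).continuousOn.mul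
      (hg's.sub (hgc.mul continuous_cos.continuousOn))
  have hanti : StrictAntiOn
      (fun x => sin x ^ (k + 1) * (g' x * sin x - g x * cos x)) (Icc 0 γ) := by
    refine strictAntiOn_of_deriv_neg (convex_Icc 0 γ) hcont fun x hx => ?_
    rw [interior_Icc] at hx
    have hs := hsin x ⟨hx.1, hx.2.le⟩
    have hg := hgpos x ⟨hx.1, hx.2.le⟩
    have hd := ((hasDerivAt_sin x).pow (k + 1)).mul
      (((hg'' x hx).mul (hasDerivAt_sin x)).sub ((hg' x hx).mul (hasDerivAt_cos x)))
    have hval := hd.deriv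
    have ho := hode x hx
    field_simp at ho
    have key : deriv (fun x => sin x ^ (k + 1) * (g' x * sin x - g x * cos x)) x
        = -(sin x ^ (k + 2) * g x * (μ - (k + 2))) := by
      refine hval.trans ?_
      simp only [Pi.pow_apply, Pi.mul_apply, Pi.sub_apply, Nat.add_sub_cancel]
      push_cast
      have hc : cos x ^ 2 = 1 - sin x ^ 2 := by linarith [sin_sq_add_cos_sq x]
      linear_combination (-(sin x ^ k)) * ho - (k + 1) * sin x ^ k * g x * hc
    rw [key, neg_lt_zero]
    exact mul_pos (mul_pos (pow_pos hs _) hg) (by linarith)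
  have h := hanti ⟨le_rfl, hθ.1.le.trans hθ.2⟩ ⟨hθ.1.le, hθ.2⟩ hθ.1
  simp only [sin_zero, ne_eq, Nat.succ_ne_zero, not_false_eq_true, zero_pow, zero_mul] at h
  exact (pos_iff_neg_of_mul_neg h).1 (pow_pos (hsin θ hθ) _)

/-- Lemma 1 of the paper: with `g` the (radial part of the) first nontrivial Neumann
eigenfunction of the Laplace–Beltrami operator on a geodesic ball of radius `γ ≤ π/2`
in `S^N`, with eigenvalue `μ > N`, the constant extension `G` of `g` beyond `γ` is such
that `G θ / sin θ` is strictly decreasing on `(0, π/2]`. -/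
theorem G_div_sin_strictAnti
    (N : ℕ) (hN : 2 ≤ N) (γ : ℝ) (hγ0 : 0 < γ) (hγ : γ ≤ π / 2)
    (μ : ℝ) (hμ : (N : ℝ) < μ)
    (a : ℝ) (ha : a = (μ - (2 / 3) * ((N : ℝ) - 1)) / (2 * (N : ℝ) + 4))
    (g g' g'' : ℝ → ℝ)
    (hgc : ContinuousOn g (Icc 0 γ))
    (hg' : ∀ θ ∈ Ioc 0 γ, HasDerivWithinAt g (g' θ) (Ioc 0 γ) θ)
    (hg'' : ∀ θ ∈ Ioc 0 γ, HasDerivWithinAt g' (g'' θ) (Ioc 0 γ) θ)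
    (hg''c : ContinuousOn g'' (Ioc 0 γ))
    (hgpos : ∀ θ ∈ Ioc 0 γ, 0 < g θ)
    (hode : ∀ θ ∈ Ioo 0 γ,
      -g'' θ - ((N : ℝ) - 1) * (cos θ / sin θ) * g' θ
        + ((N : ℝ) - 1) * g θ / sin θ ^ 2 = μ * g θ)
    (hg0 : g 0 = 0) (hg'γ : g' γ = 0)
    (hasym : (fun θ => g θ - (θ - a * θ ^ 3)) =o[𝓝[>] 0] fun θ => θ ^ 3)
    (hasym' : (fun θ => g' θ - (1 - 3 * a * θ ^ 2)) =o[𝓝[>] 0] fun θ => θ ^ 2)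
    (G : ℝ → ℝ) (hG : ∀ θ, G θ = if θ ≤ γ then g θ else g γ) :
    StrictAntiOn (fun θ => G θ / sin θ) (Ioc 0 (π / 2)) := by
  obtain ⟨k, rfl⟩ := Nat.exists_eq_add_of_le' hN
  have hnhds : ∀ θ ∈ Ioo 0 γ, Ioc 0 γ ∈ 𝓝 θ := fun θ hθ => Ioc_mem_nhds hθ.1 hθ.2
  have hd : ∀ θ ∈ Ioo 0 γ, HasDerivAt g (g' θ) θ := fun θ hθ =>
    (hg' θ ⟨hθ.1, hθ.2.le⟩).hasDerivAt (hnhds θ hθ)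
  have hW := wronskian_sin_neg (k := k) hγ (by exact_mod_cast hμ) hgc hd
    (fun θ hθ => (hg'' θ ⟨hθ.1, hθ.2.le⟩).hasDerivAt (hnhds θ hθ))
    (fun θ hθ => (hg'' θ hθ).continuousWithinAt) hgpos
    (fun θ hθ => by
      have h := hode θ hθ
      have hk : ((k + 2 : ℕ) : ℝ) - 1 = k + 1 := by push_cast; ring
      rwa [hk] at h)
    (tendsto_one_of_isLittleO_sq hasym')
  have hsin : ∀ x ∈ Ioc 0 (π / 2), 0 < sin x := fun x hx =>
    sin_pos_of_pos_of_lt_pi hx.1 (by linarith [hx.2, pi_pos])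
  have hleft : StrictAntiOn (fun θ => g θ / sin θ) (Ioc 0 γ) := by
    refine strictAntiOn_of_deriv_neg (convex_Ioc 0 γ) ?_ fun x hx => ?_
    · exact (hgc.mono Ioc_subset_Icc_self).div continuous_sin.continuousOn
        fun x hx => (hsin x ⟨hx.1, hx.2.trans hγ⟩).ne'
    · rw [interior_Ioc] at hx
      have hs := hsin x ⟨hx.1, hx.2.le.trans hγ⟩
      have h := ((hd x hx).div (hasDerivAt_sin x) hs.ne').deriv
      exact h.trans_lt (div_neg_of_neg_of_pos (hW x ⟨hx.1, hx.2.le⟩) (pow_pos hs 2))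
  have hright : StrictAntiOn (fun θ => g γ / sin θ) (Icc γ (π / 2)) := fun x hx y hy hxy =>
    div_lt_div_of_pos_left (hgpos γ ⟨hγ0, le_rfl⟩) (hsin x ⟨hγ0.trans_le hx.1, hx.2⟩)
      (sin_lt_sin_of_lt_of_le_pi_div_two (by linarith [hx.1, pi_pos]) hy.2 hxy)
  rw [← Ioc_union_Icc_eq_Ioc hγ0 hγ]
  refine StrictAntiOn.union (c := γ) (hleft.congr fun x hx => ?_) (hright.congr fun x hx => ?_)
    (isGreatest_Ioc hγ0) (isLeast_Icc hγ)
  · simp [hG, hx.2]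
  · rcases hx.1.eq_or_lt with rfl | h
    · simp [hG]
    · simp [hG, h.not_ge]
end

section
/- Let N ≥ 2 be an integer, let 0 < γ ≤ π/2 and let μ > N be a real number. Let g : [0,γ] → ℝ be continuous on [0,γ], twice continuously differentiable on (0,γ], positive on (0,γ], satisfy the equation -g''(θ) - (N-1) cot(θ) g'(θ) + (N-1) g(θ)/sin²(θ) = μ g(θ) for all θ ∈ (0,γ), satisfy g(0) = 0 and g'(γ) = 0, and satisfy the asymptotic expansions g(θ) = θ - a θ³ + o(θ³) and g'(θ) = 1 - 3 a θ² + o(θ²) as θ → 0⁺, where a = (μ - (2/3)(N-1))/(2N+4). Then the function W(θ) := g'(θ) - g(θ) cot(θ) satisfies W(θ) < 0 for every θ ∈ (0,γ). -/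
open Real Set Filter Asymptotics Topology

/-- If `g` solves the radial eigenvalue equation at `x` with eigenvalue `μ` in dimension `n + 2`,
then its weighted Wronskian with the solution `sin` for the eigenvalue `n + 2` has derivative
`(n + 2 - μ) * sin x ^ (n + 2) * g x`. -/
theorem hasDerivAt_weighted_wronskian_sin {n : ℕ} {μ x g₂ : ℝ} {g g' : ℝ → ℝ}
    (hs : sin x ≠ 0) (hg : HasDerivAt g (g' x) x) (hg' : HasDerivAt g' g₂ x)
    (hode : -g₂ - ((n : ℝ) + 1) * (cos x / sin x) * g' x
      + ((n : ℝ) + 1) * g x / sin x ^ 2 = μ * g x) :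
    HasDerivAt (fun t => sin t ^ (n + 1) * (g' t * sin t - g t * cos t))
      (((n : ℝ) + 2 - μ) * (sin x ^ (n + 2) * g x)) x := by
  have h := ((hasDerivAt_sin x).fun_pow (n + 1)).fun_mul
    ((hg'.fun_mul (hasDerivAt_sin x)).fun_sub (hg.fun_mul (hasDerivAt_cos x)))
  refine h.congr_deriv ?_
  have hg₂ : g₂ = ((n : ℝ) + 1) * g x / sin x ^ 2
      - ((n : ℝ) + 1) * (cos x / sin x) * g' x - μ * g x := by linarith
  rw [hg₂, Nat.add_sub_cancel]
  push_cast
  field_simp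
  linear_combination (-(n + 1) * g x * sin x ^ (n + 1)) * sin_sq_add_cos_sq x

/-- A function asymptotic to `c - d * t ^ 2` up to `o(t ^ 2)` at `0⁺` tends to `c`. -/
theorem tendsto_of_isLittleO_sub_quadratic {f : ℝ → ℝ} {c d : ℝ}
    (h : (fun t => f t - (c - d * t ^ 2)) =o[𝓝[>] 0] fun t => t ^ 2) :
    Tendsto f (𝓝[>] 0) (𝓝 c) := by
  have hsq : Tendsto (fun t : ℝ => t ^ 2) (𝓝[>] 0) (𝓝 0) := by
    have : Tendsto (fun t : ℝ => t ^ 2) (𝓝 0) (𝓝 (0 ^ 2)) := (continuous_pow 2).tendsto 0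
    simpa using this.mono_left nhdsWithin_le_nhds
  have hlim := (h.trans_tendsto hsq).add ((hsq.const_mul d).const_sub c)
  simpa using hlim

/-- With `g` the (radial part of the) first nontrivial Neumann eigenfunction of the
Laplace–Beltrami operator on a geodesic ball of radius `γ ≤ π/2` in `S^N`, with
eigenvalue `μ > N`, the function `W θ = g' θ - g θ * cot θ` is negative on `(0, γ)`. -/
theorem W_neg
    (N : ℕ) (hN : 2 ≤ N) (γ : ℝ) (hγ0 : 0 < γ) (hγ : γ ≤ π / 2)
    (μ : ℝ) (hμ : (N : ℝ) < μ)
    (a : ℝ) (ha : a = (μ - (2 / 3) * ((N : ℝ) - 1)) / (2 * (N : ℝ) + 4))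
    (g g' g'' : ℝ → ℝ)
    (hgc : ContinuousOn g (Icc 0 γ))
    (hg' : ∀ θ ∈ Ioc 0 γ, HasDerivWithinAt g (g' θ) (Ioc 0 γ) θ)
    (hg'' : ∀ θ ∈ Ioc 0 γ, HasDerivWithinAt g' (g'' θ) (Ioc 0 γ) θ)
    (hg''c : ContinuousOn g'' (Ioc 0 γ))
    (hgpos : ∀ θ ∈ Ioc 0 γ, 0 < g θ)
    (hode : ∀ θ ∈ Ioo 0 γ,
      -g'' θ - ((N : ℝ) - 1) * (cos θ / sin θ) * g' θ
        + ((N : ℝ) - 1) * g θ / sin θ ^ 2 = μ * g θ)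
    (hg0 : g 0 = 0) (hg'γ : g' γ = 0)
    (hasym : (fun θ => g θ - (θ - a * θ ^ 3)) =o[𝓝[>] 0] fun θ => θ ^ 3)
    (hasym' : (fun θ => g' θ - (1 - 3 * a * θ ^ 2)) =o[𝓝[>] 0] fun θ => θ ^ 2) :
    ∀ θ ∈ Ioo 0 γ, g' θ - g θ * (cos θ / sin θ) < 0 := by
  intro θ hθ
  obtain ⟨n, rfl⟩ : ∃ n, N = n + 2 := ⟨N - 2, by omega⟩
  push_cast at hode hμ
  have hsin : ∀ x ∈ Ioo 0 γ, 0 < sin x := fun x hx =>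
    sin_pos_of_pos_of_lt_pi hx.1 (by linarith [hx.2, pi_pos])
  have hder : ∀ x ∈ Ioo 0 γ,
      HasDerivAt (fun t => sin t ^ (n + 1) * (g' t * sin t - g t * cos t))
        (((n : ℝ) + 2 - μ) * (sin x ^ (n + 2) * g x)) x := fun x hx => by
    have hnhds : Ioc 0 γ ∈ 𝓝 x := Ioc_mem_nhds hx.1 hx.2
    have hx' := Ioo_subset_Ioc_self hx
    refine hasDerivAt_weighted_wronskian_sin (hsin x hx).ne' ((hg' x hx').hasDerivAt hnhds)
      ((hg'' x hx').hasDerivAt hnhds) ?_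
    rw [← hode x hx]
    ring
  have hcont : ContinuousOn (fun t => sin t ^ (n + 1) * (g' t * sin t - g t * cos t))
      (Icc 0 θ) := by
    intro x hx
    rcases hx.1.eq_or_lt with rfl | hx0
    · have hsin0 : Tendsto sin (𝓝[>] 0) (𝓝 0) := by
        simpa using (continuous_sin.tendsto 0).mono_left nhdsWithin_le_nhds
      have hcos0 : Tendsto cos (𝓝[>] 0) (𝓝 1) := by
        simpa using (continuous_cos.tendsto 0).mono_left nhdsWithin_le_nhds
      have hg0' : Tendsto g (𝓝[>] 0) (𝓝 0) := by
        have := (hgc 0 ⟨le_rfl, hγ0.le⟩).mono Ioc_subset_Icc_self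
        rwa [ContinuousWithinAt, hg0, nhdsWithin_Ioc_eq_nhdsGT hγ0] at this
      have hlim := (hsin0.pow (n + 1)).mul
        (((tendsto_of_isLittleO_sub_quadratic hasym').mul hsin0).sub (hg0'.mul hcos0))
      refine ContinuousWithinAt.mono ?_ Icc_subset_Ici_self
      rw [← continuousWithinAt_Ioi_iff_Ici]
      simpa [ContinuousWithinAt] using hlim
    · exact (hder x ⟨hx0, hx.2.trans_lt hθ.2⟩).continuousAt.continuousWithinAt
  have hanti := strictAntiOn_of_deriv_neg (convex_Icc 0 θ) hcont fun x hx => by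
    rw [interior_Icc] at hx
    have hx' : x ∈ Ioo 0 γ := ⟨hx.1, hx.2.trans hθ.2⟩
    rw [(hder x hx').deriv]
    exact mul_neg_of_neg_of_pos (by linarith)
      (mul_pos (pow_pos (hsin x hx') _) (hgpos x (Ioo_subset_Ioc_self hx')))
  have hneg := hanti (left_mem_Icc.2 hθ.1.le) (right_mem_Icc.2 hθ.1.le) hθ.1
  have hs := hsin θ hθ
  simp only [sin_zero, ne_eq, Nat.succ_ne_zero, not_false_eq_true, zero_pow, zero_mul] at hneg
  have hw := neg_of_mul_neg_right hneg (pow_pos hs _).le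
  have hW : g' θ - g θ * (cos θ / sin θ) = (g' θ * sin θ - g θ * cos θ) / sin θ := by
    field_simp
  rw [hW]
  exact div_neg_of_neg_of_pos hw hs
end

section
/- Let N ≥ 2 be an integer, let μ > N be a real number, and let 0 < θ̃ < π/2. Suppose g is twice differentiable in a neighborhood of θ̃ with g(θ̃) > 0, that the equation -g''(θ̃) - (N-1) cot(θ̃) g'(θ̃) + (N-1) g(θ̃)/sin²(θ̃) = μ g(θ̃) holds, and that W'(θ̃) = 0, where W(θ) := g'(θ) - g(θ) cot(θ) (equivalently, g''(θ̃) - g'(θ̃) cot(θ̃) + g(θ̃)/sin²(θ̃) = 0). Then N · W(θ̃) · cot(θ̃) = (N - μ) g(θ̃); in particular W(θ̃) < 0. -/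
open Real Set Filter Asymptotics Topology

/-- The key identity at an interior critical point `θ̃` of `W θ = g' θ - g θ * cot θ`:
if `g` satisfies the radial eigenvalue equation at `θ̃` with `μ > N`, `g θ̃ > 0`, and
`W' θ̃ = 0` (i.e. `g'' θ̃ - g' θ̃ * cot θ̃ + g θ̃ / sin² θ̃ = 0`), then
`N * W θ̃ * cot θ̃ = (N - μ) * g θ̃`; in particular `W θ̃ < 0`. -/
theorem critical_point_identity
    (N : ℕ) (hN : 2 ≤ N) (μ : ℝ) (hμ : (N : ℝ) < μ)
    (θ : ℝ) (hθ0 : 0 < θ) (hθ : θ < π / 2)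
    (g g' g'' : ℝ → ℝ)
    (hd : ∀ᶠ t in 𝓝 θ, HasDerivAt g (g' t) t)
    (hd' : ∀ᶠ t in 𝓝 θ, HasDerivAt g' (g'' t) t)
    (hgpos : 0 < g θ)
    (hode : -g'' θ - ((N : ℝ) - 1) * (cos θ / sin θ) * g' θ
        + ((N : ℝ) - 1) * g θ / sin θ ^ 2 = μ * g θ)
    (hW' : g'' θ - g' θ * (cos θ / sin θ) + g θ / sin θ ^ 2 = 0) :
    (N : ℝ) * (g' θ - g θ * (cos θ / sin θ)) * (cos θ / sin θ) = ((N : ℝ) - μ) * g θ ∧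
      g' θ - g θ * (cos θ / sin θ) < 0 := by
  have hsin : 0 < sin θ := sin_pos_of_pos_of_lt_pi hθ0 (by linarith [pi_pos])
  have hcos : 0 < cos θ := cos_pos_of_mem_Ioo ⟨by linarith [pi_pos], hθ⟩
  have hcot : 0 < cos θ / sin θ := div_pos hcos hsin
  have hcsc : (sin θ ^ 2)⁻¹ = 1 + (cos θ / sin θ) ^ 2 := by
    field_simp
    exact (sin_sq_add_cos_sq θ).symm
  rw [div_eq_mul_inv _ (sin θ ^ 2), hcsc] at hode hW'
  have hid : (N : ℝ) * (g' θ - g θ * (cos θ / sin θ)) * (cos θ / sin θ)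
      = ((N : ℝ) - μ) * g θ := by
    linear_combination -hode - hW'
  refine ⟨hid, ?_⟩
  by_contra! hW
  have hlhs : 0 ≤ (N : ℝ) * (g' θ - g θ * (cos θ / sin θ)) * (cos θ / sin θ) :=
    mul_nonneg (mul_nonneg N.cast_nonneg hW) hcot.le
  have hrhs : ((N : ℝ) - μ) * g θ < 0 := mul_neg_of_neg_of_pos (sub_neg.2 hμ) hgpos
  linarith
end

section
/- Let N ≥ 2 be an integer and let G : ℝ → ℝ be differentiable. For x ∈ ℝ^N with x ≠ 0, set s = |x| (the Euclidean norm), θ = 2 arctan(s), p = 2/(1+s²), and define Φ_i : ℝ^N \ {0} → ℝ by Φ_i(x) = G(θ) x_i / s for i = 1,…,N. Then for every x ≠ 0, the sum of the squared Euclidean norms of the gradients satisfies ∑_{i=1}^N |∇Φ_i(x)|² = p² G'(θ)² + (N-1) G(θ)²/s²; equivalently, since sin(θ) = p·s, (1/p²) ∑_{i=1}^N |∇Φ_i(x)|² = G'(θ)² + (N-1) G(θ)²/sin²(θ). -/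
open Real Set

/-- Gradient of the product of a radial profile and a coordinate, away from the origin. -/
theorem hasGradientAt_radial_mul_coord {ι : Type*} [Fintype ι] [DecidableEq ι]
    {f : ℝ → ℝ} {f' : ℝ} {x : EuclideanSpace ℝ ι} (hx : x ≠ 0)
    (hf : HasDerivAt f f' ‖x‖) (i : ι) :
    HasGradientAt (fun y : EuclideanSpace ℝ ι => f ‖y‖ * y i)
      ((f' * x i / ‖x‖) • x + f ‖x‖ • EuclideanSpace.single i (1 : ℝ)) x := by
  have hs : ‖x‖ ≠ 0 := norm_ne_zero_iff.mpr hx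
  have hnorm : HasFDerivAt (fun y : EuclideanSpace ℝ ι => ‖y‖) (‖x‖⁻¹ • innerSL ℝ x) x := by
    have h := (hasStrictFDerivAt_norm_sq x).hasFDerivAt.sqrt (pow_ne_zero 2 hs)
    simp only [Real.sqrt_sq (norm_nonneg _)] at h
    refine h.congr_fderiv (ContinuousLinearMap.ext fun v => ?_)
    simp
    field_simp
  have hcoord : HasFDerivAt (fun y : EuclideanSpace ℝ ι => y i)
      (EuclideanSpace.proj i : EuclideanSpace ℝ ι →L[ℝ] ℝ) x :=
    (EuclideanSpace.proj i : EuclideanSpace ℝ ι →L[ℝ] ℝ).hasFDerivAt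
  have h := (hf.comp_hasFDerivAt x hnorm).mul hcoord
  rw [hasGradientAt_iff_hasFDerivAt]
  refine h.congr_fderiv (ContinuousLinearMap.ext fun v => ?_)
  simp [EuclideanSpace.inner_single_left]
  field_simp
  ring

/-- The sum over the coordinates of the squared gradient norms of `y ↦ f ‖y‖ * y i`. -/
theorem sum_sq_norm_gradient_radial_mul_coord {ι : Type*} [Fintype ι]
    {f : ℝ → ℝ} {f' : ℝ} {x : EuclideanSpace ℝ ι} (hx : x ≠ 0)
    (hf : HasDerivAt f f' ‖x‖) :
    ∑ i, ‖gradient (fun y : EuclideanSpace ℝ ι => f ‖y‖ * y i) x‖ ^ 2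
      = (f' * ‖x‖ + f ‖x‖) ^ 2 + ((Fintype.card ι : ℝ) - 1) * f ‖x‖ ^ 2 := by
  classical
  have hs : ‖x‖ ≠ 0 := norm_ne_zero_iff.mpr hx
  have hterm (i : ι) : ‖gradient (fun y : EuclideanSpace ℝ ι => f ‖y‖ * y i) x‖ ^ 2
      = (f' ^ 2 + 2 * f' * f ‖x‖ / ‖x‖) * x i ^ 2 + f ‖x‖ ^ 2 := by
    rw [(hasGradientAt_radial_mul_coord hx hf i).gradient, norm_add_sq_real, norm_smul,
      norm_smul, inner_smul_left, inner_smul_right, EuclideanSpace.inner_single_right,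
      PiLp.norm_single, mul_pow, mul_pow, Real.norm_eq_abs, Real.norm_eq_abs,
      sq_abs, sq_abs]
    simp
    field_simp
  simp_rw [hterm]
  rw [Finset.sum_add_distrib, ← Finset.mul_sum, ← EuclideanSpace.real_norm_sq_eq,
    Finset.sum_const, Finset.card_univ, nsmul_eq_mul]
  field_simp
  ring

/-- For the test functions `Φ_i x = G(2 arctan ‖x‖) x_i / ‖x‖` on `ℝ^N \ {0}` (stereographic
coordinates on the sphere, with conformal factor `p = 2/(1+‖x‖²)` and azimuthal angle
`θ = 2 arctan ‖x‖`), the sum of the squared Euclidean norms of the gradients is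
`p² G'(θ)² + (N-1) G(θ)²/‖x‖²`, i.e. `(1/p²) ∑ |∇Φ_i|² = G'(θ)² + (N-1) G(θ)²/sin²θ`. -/
theorem sum_sq_gradients
    (N : ℕ) (hN : 2 ≤ N) (G G' : ℝ → ℝ) (hG : ∀ t, HasDerivAt G (G' t) t)
    (x : EuclideanSpace ℝ (Fin N)) (hx : x ≠ 0) :
    ∑ i : Fin N,
        ‖gradient (fun y : EuclideanSpace ℝ (Fin N) => G (2 * arctan ‖y‖) * y i / ‖y‖) x‖ ^ 2
      = (2 / (1 + ‖x‖ ^ 2)) ^ 2 * G' (2 * arctan ‖x‖) ^ 2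
        + ((N : ℝ) - 1) * G (2 * arctan ‖x‖) ^ 2 / ‖x‖ ^ 2 := by
  have hs : ‖x‖ ≠ 0 := norm_ne_zero_iff.mpr hx
  have hf := ((hG (2 * arctan ‖x‖)).comp ‖x‖ ((hasDerivAt_arctan ‖x‖).const_mul 2)).div
    (hasDerivAt_id ‖x‖) hs
  have h := sum_sq_norm_gradient_radial_mul_coord hx hf
  simp only [Pi.div_apply, Function.comp_apply, id_eq, div_mul_eq_mul_div, Fintype.card_fin] at h
  rw [h]
  have hp : 1 + ‖x‖ ^ 2 ≠ 0 := by positivity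
  field_simp
  ring
end
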